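/- Let Δ be a (v,b,r,k)-design with r > 1, and suppose there is a positive integer μ such that every pair of distinct non-disjoint blocks of Δ intersect in exactly μ treatments. Then η₀(Δ) = v(v − k − (r−1)(k−μ))/2 holds if and only if Δ is a μ-fold inflation of a (v/μ, b, r, k/μ)-design with the property that every pair of distinct non-disjoint blocks intersect in exactly one treatment. -/

import Mathlib

open Polynomial

/-- A `(v,b,r,k)`-design: `b` blocks (indexed by `Fin b`, so repeated blocks are allowed),
each a `k`-subset of the `v` treatments, with each treatment in exactly `r` blocks. -/
structure BlockDesign (v b r k : ℕ) where
  blocks : Fin b → Finset (Fin v)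
  blockSize : ∀ j, (blocks j).card = k
  replication : ∀ α : Fin v, (Finset.univ.filter fun j => α ∈ blocks j).card = r

namespace BlockDesign

variable {v b r k : ℕ}

/-- The concurrence of two treatments: the number of blocks containing both. -/
def concurrence (D : BlockDesign v b r k) (α β : Fin v) : ℕ :=
  (Finset.univ.filter fun j => α ∈ D.blocks j ∧ β ∈ D.blocks j).card

/-- The scaled information matrix `F(Δ) = I − (rk)⁻¹ Λ`. -/
noncomputable def infoMatrix (D : BlockDesign v b r k) : Matrix (Fin v) (Fin v) ℝ :=
  1 - ((r : ℝ) * (k : ℝ))⁻¹ • Matrix.of (fun α β => (D.concurrence α β : ℝ))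

/-- `η_i(Δ)`: the number of unordered pairs of distinct treatments with concurrence `i`. -/
def eta (D : BlockDesign v b r k) (i : ℕ) : ℕ :=
  (Finset.univ.filter fun p : Fin v × Fin v => p.1 < p.2 ∧ D.concurrence p.1 p.2 = i).card

/-- `π : Fin b → Fin r` assigns blocks to parallel classes, each class partitioning
the treatment set. -/
def IsResolution (D : BlockDesign v b r k) (π : Fin b → Fin r) : Prop :=
  ∀ (c : Fin r) (α : Fin v), ∃! j : Fin b, π j = c ∧ α ∈ D.blocks j

def IsResolvable (D : BlockDesign v b r k) : Prop :=
  k < v ∧ 1 < r ∧ ∃ π : Fin b → Fin r, D.IsResolution π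

def IsAffineResolvable (D : BlockDesign v b r k) : Prop :=
  k < v ∧ 1 < r ∧ ∃ π : Fin b → Fin r, D.IsResolution π ∧
    ∃ μ : ℕ, 0 < μ ∧ ∀ j j' : Fin b, π j ≠ π j' → (D.blocks j ∩ D.blocks j').card = μ

/-- The canonical efficiency factors, as a multiset: the eigenvalues (with multiplicity,
i.e. the roots of the characteristic polynomial) of the scaled information matrix,
with one copy of the eigenvalue `0` removed. -/
noncomputable def effFactors (D : BlockDesign v b r k) : Multiset ℝ :=
  (D.infoMatrix.charpoly.roots).erase 0

/-- The canonical efficiency factors, sorted increasingly. -/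
noncomputable def sortedEff (D : BlockDesign v b r k) : List ℝ :=
  D.effFactors.sort (· ≤ ·)

/-- `D` is Schur optimal in a class `C` of `(v,b,r,k)`-designs. -/
def SchurOptimalIn (D : BlockDesign v b r k) (C : Set (BlockDesign v b r k)) : Prop :=
  D ∈ C ∧ ∀ Γ ∈ C, ∀ ℓ : ℕ, 1 ≤ ℓ → ℓ ≤ v - 1 →
    ((Γ.sortedEff).take ℓ).sum ≤ ((D.sortedEff).take ℓ).sum

/-- `D` is an `s`-fold inflation of `E`. -/
def IsInflation (s : ℕ) {w m : ℕ} (D : BlockDesign v b r k) (E : BlockDesign w b r m) : Prop :=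
  ∃ e : Fin v ≃ Fin w × Fin s, ∀ (α : Fin v) (j : Fin b), α ∈ D.blocks j ↔ (e α).1 ∈ E.blocks j

/-- `D` is a `(v,b,r,k,λ)`-balanced incomplete-block design. -/
def IsBIBD (D : BlockDesign v b r k) (lam : ℕ) : Prop :=
  1 < k ∧ k < v ∧ ∀ α β : Fin v, α ≠ β → D.concurrence α β = lam

end BlockDesign

/-- An `(n×n)/k` semi-Latin square. -/
structure SemiLatinSquare (n k : ℕ) where
  block : Fin n → Fin n → Finset (Fin (n * k))
  blockSize : ∀ i j, (block i j).card = k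
  row_once : ∀ (i : Fin n) (α : Fin (n * k)), ∃! j : Fin n, α ∈ block i j
  col_once : ∀ (j : Fin n) (α : Fin (n * k)), ∃! i : Fin n, α ∈ block i j

namespace SemiLatinSquare

variable {n k : ℕ}

/-- `S` is uniform with intersection parameter `μ`. -/
def UniformWith (S : SemiLatinSquare n k) (μ : ℕ) : Prop :=
  0 < μ ∧ ∀ i j i' j' : Fin n, i ≠ i' → j ≠ j' →
    (S.block i j ∩ S.block i' j').card = μ

def IsUniform (S : SemiLatinSquare n k) : Prop := ∃ μ : ℕ, S.UniformWith μ

/-- Concurrence in the underlying block design of `S`. -/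
def concurrence (S : SemiLatinSquare n k) (α β : Fin (n * k)) : ℕ :=
  (Finset.univ.filter fun p : Fin n × Fin n =>
    α ∈ S.block p.1 p.2 ∧ β ∈ S.block p.1 p.2).card

/-- The scaled information matrix of the underlying block design of `S`
(which is an `(nk, n², n, k)`-design, so `rk = nk`). -/
noncomputable def infoMatrix (S : SemiLatinSquare n k) :
    Matrix (Fin (n * k)) (Fin (n * k)) ℝ :=
  1 - ((n : ℝ) * (k : ℝ))⁻¹ • Matrix.of (fun α β => (S.concurrence α β : ℝ))

/-- `η_i(S)`: the number of unordered pairs of distinct treatments with concurrence `i`. -/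
def eta (S : SemiLatinSquare n k) (i : ℕ) : ℕ :=
  (Finset.univ.filter fun p : Fin (n * k) × Fin (n * k) =>
    p.1 < p.2 ∧ S.concurrence p.1 p.2 = i).card

/-- Canonical efficiency factors of `S` (eigenvalues of the scaled information matrix,
with multiplicity, after removing one copy of `0`). -/
noncomputable def effFactors (S : SemiLatinSquare n k) : Multiset ℝ :=
  (S.infoMatrix.charpoly.roots).erase 0

noncomputable def sortedEff (S : SemiLatinSquare n k) : List ℝ :=
  S.effFactors.sort (· ≤ ·)

/-- `S` is Schur optimal in the class of all `(n×n)/k` semi-Latin squares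
(on the same treatment set). -/
def SchurOptimal (S : SemiLatinSquare n k) : Prop :=
  ∀ T : SemiLatinSquare n k, ∀ ℓ : ℕ, 1 ≤ ℓ → ℓ ≤ n * k - 1 →
    ((T.sortedEff).take ℓ).sum ≤ ((S.sortedEff).take ℓ).sum

/-- `S` is an `s`-fold inflation of `T`. -/
def IsInflation (s : ℕ) (S : SemiLatinSquare n (s * k)) (T : SemiLatinSquare n k) : Prop :=
  ∃ e : Fin (n * (s * k)) ≃ Fin (n * k) × Fin s,
    ∀ (α : Fin (n * (s * k))) (i j : Fin n), α ∈ S.block i j ↔ (e α).1 ∈ T.block i j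

/-- The PV-aberration vector `(η₀(S), …, η_n(S))`. -/
def etaVec (S : SemiLatinSquare n k) : List ℕ :=
  (List.range (n + 1)).map (S.eta)

/-- `S` has minimum PV aberration in the class of uniform `(n×n)/k` semi-Latin squares:
no uniform square has a lexicographically smaller `η`-vector. -/
def MinPVAberration (S : SemiLatinSquare n k) : Prop :=
  ∀ T : SemiLatinSquare n k, T.IsUniform → ¬ List.Lex (· < ·) (T.etaVec) (S.etaVec)

end SemiLatinSquare

/-- `L` is a Latin square of order `n` (symbols `Fin n`). -/
def IsLatin (n : ℕ) (L : Fin n → Fin n → Fin n) : Prop :=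
  (∀ (i a : Fin n), ∃! j : Fin n, L i j = a) ∧ (∀ (j a : Fin n), ∃! i : Fin n, L i j = a)

/-- Two Latin squares of order `n` are orthogonal: each pair of symbols occurs together
in exactly one cell of the superposition. -/
def AreOrthogonal {n : ℕ} (L M : Fin n → Fin n → Fin n) : Prop :=
  ∀ a b : Fin n, ∃! p : Fin n × Fin n, L p.1 p.2 = a ∧ M p.1 p.2 = b

/-- A family of mutually orthogonal Latin squares of order `n`. -/
def IsMOLS {n m : ℕ} (L : Fin m → Fin n → Fin n → Fin n) : Prop :=
  (∀ t, IsLatin n (L t)) ∧ ∀ t t', t ≠ t' → AreOrthogonal (L t) (L t')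

/-- `S` is a `μ`-fold inflation of a superposition of `n−1` mutually orthogonal
Latin squares of order `n` (with pairwise disjoint symbol sets): the treatments of `S`
are identified with triples `((t, a), c)` where `t` indexes the Latin square, `a` is a
symbol, and `c` is the inflation index, and treatment `((t,a),c)` lies in block `(i,j)`
iff Latin square `t` has symbol `a` in cell `(i,j)`. -/
def SemiLatinSquare.IsInflatedMOLSSuperposition {n k : ℕ} (μ : ℕ)
    (S : SemiLatinSquare n k) : Prop :=
  ∃ L : Fin (n - 1) → Fin n → Fin n → Fin n, IsMOLS L ∧
    ∃ e : Fin (n * k) ≃ (Fin (n - 1) × Fin n) × Fin μ,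
      ∀ (α : Fin (n * k)) (i j : Fin n),
        α ∈ S.block i j ↔ L (e α).1.1 i j = (e α).1.2

namespace BlockDesign

variable {v b r k : ℕ}

lemma conc_comm (D : BlockDesign v b r k) (α β : Fin v) :
    D.concurrence α β = D.concurrence β α := by
  unfold concurrence
  congr 1
  ext j
  simp [and_comm]

lemma conc_self (D : BlockDesign v b r k) (α : Fin v) : D.concurrence α α = r := by
  have := D.replication α
  simpa [concurrence] using this

/-- number of treatments with concurrence zero with `α` -/
def zz (D : BlockDesign v b r k) (α : Fin v) : ℕ :=
  (Finset.univ.filter fun β => D.concurrence α β = 0).card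

lemma two_eta (D : BlockDesign v b r k) (hr : 1 < r) :
    2 * D.eta 0 = ∑ α, D.zz α := by
  have h1 : ∑ α, D.zz α =
      (Finset.univ.filter fun p : Fin v × Fin v => D.concurrence p.1 p.2 = 0).card := by
    simp only [zz, Finset.card_filter]
    rw [Fintype.sum_prod_type]
  have h2 : (Finset.univ.filter fun p : Fin v × Fin v => D.concurrence p.1 p.2 = 0)
      = (Finset.univ.filter fun p : Fin v × Fin v => p.1 < p.2 ∧ D.concurrence p.1 p.2 = 0) ∪
        (Finset.univ.filter fun p : Fin v × Fin v => p.2 < p.1 ∧ D.concurrence p.1 p.2 = 0) := by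
    ext ⟨x, y⟩
    simp only [Finset.mem_filter, Finset.mem_univ, true_and, Finset.mem_union]
    constructor
    · intro h
      rcases lt_trichotomy x y with h' | h' | h'
      · exact Or.inl ⟨h', h⟩
      · subst h'
        rw [conc_self] at h
        omega
      · exact Or.inr ⟨h', h⟩
    · rintro (h | h) <;> exact h.2
  have h3 : (Finset.univ.filter fun p : Fin v × Fin v =>
      p.2 < p.1 ∧ D.concurrence p.1 p.2 = 0).card = D.eta 0 := by
    unfold eta
    apply Finset.card_bij (fun p _ => (p.2, p.1))
    · rintro ⟨x, y⟩ h
      simp only [Finset.mem_filter, Finset.mem_univ, true_and] at h ⊢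
      rw [conc_comm]; exact h
    · rintro ⟨x, y⟩ _ ⟨x', y'⟩ _ h
      simp only [Prod.mk.injEq] at h ⊢
      exact ⟨h.2, h.1⟩
    · rintro ⟨x, y⟩ h
      simp only [Finset.mem_filter, Finset.mem_univ, true_and] at h
      refine ⟨(y, x), ?_, rfl⟩
      simp only [Finset.mem_filter, Finset.mem_univ, true_and]
      rw [conc_comm]; exact h
  rw [h1, h2, Finset.card_union_of_disjoint, h3]
  · unfold eta; omega
  · rw [Finset.disjoint_left]
    rintro ⟨x, y⟩ h h'
    simp only [Finset.mem_filter, Finset.mem_univ, true_and] at h h'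
    exact absurd h.1 (not_lt.mpr h'.1.le)

lemma exists_other (D : BlockDesign v b r k) (hr : 1 < r) (α : Fin v) :
    ∃ j j', j ≠ j' ∧ α ∈ D.blocks j ∧ α ∈ D.blocks j' := by
  have := D.replication α
  rw [← this, Finset.one_lt_card] at hr
  obtain ⟨a, ha, c, hc, hac⟩ := hr
  simp at ha hc
  exact ⟨a, c, hac, ha, hc⟩

def IntProp (D : BlockDesign v b r k) (μ : ℕ) : Prop :=
  ∀ j j' : Fin b, j ≠ j' → (D.blocks j ∩ D.blocks j').Nonempty →
      (D.blocks j ∩ D.blocks j').card = μ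

lemma mu_le (D : BlockDesign v b r k) {μ : ℕ} (hr : 1 < r) (hint : D.IntProp μ) (α : Fin v) :
    μ ≤ k := by
  obtain ⟨j, j', h, h1, h2⟩ := D.exists_other hr α
  rw [← hint j j' h ⟨α, by simp [h1, h2]⟩]
  exact (Finset.card_le_card Finset.inter_subset_left).trans (D.blockSize j).le

lemma sum_conc (D : BlockDesign v b r k) {μ : ℕ} (hint : D.IntProp μ)
    (α : Fin v) (j0 : Fin b) (h0 : α ∈ D.blocks j0) :
    ∑ β ∈ (D.blocks j0)ᶜ, D.concurrence α β = (r - 1) * (k - μ) := by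
  have h1 : ∀ β, D.concurrence α β =
      ∑ j ∈ Finset.univ.filter (fun j => α ∈ D.blocks j), if β ∈ D.blocks j then 1 else 0 := by
    intro β
    rw [← Finset.card_filter, Finset.filter_filter]
    rfl
  simp only [h1]
  rw [Finset.sum_comm]
  simp only [← Finset.card_filter]
  have hm : j0 ∈ Finset.univ.filter (fun j => α ∈ D.blocks j) := by simp [h0]
  rw [← Finset.add_sum_erase _ _ hm]
  have h2 : ((D.blocks j0)ᶜ.filter (fun β => β ∈ D.blocks j0)).card = 0 := by
    rw [Finset.card_eq_zero, Finset.filter_eq_empty_iff]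
    intro x hx
    simpa using hx
  rw [h2, zero_add, Finset.sum_const_nat (m := k - μ), Finset.card_erase_of_mem hm,
    D.replication]
  intro j hj
  simp only [Finset.mem_erase, Finset.mem_filter, Finset.mem_univ, true_and] at hj
  have h3 : (D.blocks j0)ᶜ.filter (fun β => β ∈ D.blocks j) = D.blocks j \ D.blocks j0 := by
    ext x; simp [and_comm]
  rw [h3, Finset.card_sdiff, D.blockSize, hint j0 j (Ne.symm hj.1) ⟨α, by simp [h0, hj.2]⟩]

lemma sum_conc' (D : BlockDesign v b r k) {μ : ℕ} (hint : D.IntProp μ)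
    (α : Fin v) (j0 : Fin b) (h0 : α ∈ D.blocks j0) :
    ∑ β ∈ (D.blocks j0)ᶜ, (D.concurrence α β + if D.concurrence α β = 0 then 1 else 0)
      = (r - 1) * (k - μ) + D.zz α := by
  rw [Finset.sum_add_distrib, sum_conc D hint α j0 h0, ← Finset.card_filter]
  congr 2
  ext β
  simp only [Finset.mem_filter, Finset.mem_compl, Finset.mem_univ, true_and,
    and_iff_right_iff_imp]
  intro h hβ
  simp only [concurrence, Finset.card_eq_zero, Finset.filter_eq_empty_iff] at h
  exact h (Finset.mem_univ j0) ⟨h0, hβ⟩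

lemma card_compl_block (D : BlockDesign v b r k) (j0 : Fin b) :
    ∑ _β ∈ (D.blocks j0)ᶜ, 1 + k = v := by
  rw [Finset.sum_const, smul_eq_mul, mul_one]
  have := Finset.card_compl_add_card (D.blocks j0)
  rwa [D.blockSize, Fintype.card_fin] at this

lemma bound (D : BlockDesign v b r k) {μ : ℕ} (hr : 1 < r) (hint : D.IntProp μ) (α : Fin v) :
    v ≤ k + (r - 1) * (k - μ) + D.zz α := by
  obtain ⟨j, _, _, h1, _⟩ := D.exists_other hr α
  have := D.card_compl_block j
  have h2 := D.sum_conc' hint α j h1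
  have h3 : ∑ _β ∈ (D.blocks j)ᶜ, 1 ≤ ∑ β ∈ (D.blocks j)ᶜ,
      (D.concurrence α β + if D.concurrence α β = 0 then 1 else 0) := by
    apply Finset.sum_le_sum
    intro β _
    split_ifs <;> omega
  omega

lemma bound_eq (D : BlockDesign v b r k) {μ : ℕ} (hint : D.IntProp μ) (α : Fin v)
    (j : Fin b) (h1 : α ∈ D.blocks j) :
    v = k + (r - 1) * (k - μ) + D.zz α ↔ ∀ β, β ∉ D.blocks j → D.concurrence α β ≤ 1 := by
  have := D.card_compl_block j
  have h2 := D.sum_conc' hint α j h1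
  have h3 := Finset.sum_eq_sum_iff_of_le (s := (D.blocks j)ᶜ) (f := fun _ => 1)
    (g := fun β => (D.concurrence α β + if D.concurrence α β = 0 then 1 else 0))
    (by intro β _; split_ifs <;> omega)
  have h4 : v = k + (r - 1) * (k - μ) + D.zz α ↔ ∑ _β ∈ (D.blocks j)ᶜ, 1 =
      ∑ β ∈ (D.blocks j)ᶜ, (D.concurrence α β + if D.concurrence α β = 0 then 1 else 0) := by
    omega
  rw [h4, h3]
  apply forall_congr'
  intro β
  rw [Finset.mem_compl]
  apply imp_congr_right
  intro _
  split_ifs <;> omega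

/-- treatments with the same blocks as `α` -/
def cls (D : BlockDesign v b r k) (α : Fin v) : Finset (Fin v) :=
  Finset.univ.filter fun β => ∀ j, α ∈ D.blocks j ↔ β ∈ D.blocks j

lemma two_le_conc (D : BlockDesign v b r k) (α β : Fin v) :
    1 < D.concurrence α β ↔ ∃ j j', j ≠ j' ∧ (α ∈ D.blocks j ∧ β ∈ D.blocks j) ∧
      (α ∈ D.blocks j' ∧ β ∈ D.blocks j') := by
  rw [concurrence, Finset.one_lt_card]
  constructor
  · rintro ⟨a, ha, c, hc, hac⟩
    simp only [Finset.mem_filter, Finset.mem_univ, true_and] at ha hc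
    exact ⟨a, c, hac, ha, hc⟩
  · rintro ⟨a, c, hac, ha, hc⟩
    exact ⟨a, by simp [ha], c, by simp [hc], hac⟩

lemma cls_iff (D : BlockDesign v b r k) {μ : ℕ} (hr : 1 < r) (hint : D.IntProp μ) (α : Fin v) :
    v = k + (r - 1) * (k - μ) + D.zz α ↔ (D.cls α).card = μ := by
  obtain ⟨j, j', hne, h1, h2⟩ := D.exists_other hr α
  constructor
  · intro h
    rw [← hint j j' hne ⟨α, by simp [h1, h2]⟩]
    congr 1
    ext β
    simp only [cls, Finset.mem_filter, Finset.mem_univ, true_and, Finset.mem_inter]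
    constructor
    · intro hβ
      exact ⟨(hβ j).1 h1, (hβ j').1 h2⟩
    · rintro ⟨hb1, hb2⟩
      have hc : 1 < D.concurrence α β :=
        (D.two_le_conc α β).2 ⟨j, j', hne, ⟨h1, hb1⟩, h2, hb2⟩
      have key : ∀ i, α ∈ D.blocks i → β ∈ D.blocks i := by
        intro i hi
        by_contra hn
        have := (D.bound_eq hint α i hi).1 h β hn
        omega
      have hs : (Finset.univ.filter fun i => α ∈ D.blocks i) =
          Finset.univ.filter fun i => β ∈ D.blocks i := by
        apply Finset.eq_of_subset_of_card_le
        · intro i hi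
          simp only [Finset.mem_filter, Finset.mem_univ, true_and] at hi ⊢
          exact key i hi
        · rw [D.replication, D.replication]
      intro i
      have := Finset.ext_iff.1 hs i
      simpa using this
  · intro h
    rw [D.bound_eq hint α j h1]
    intro β hβ
    by_contra hc
    rw [not_le, two_le_conc] at hc
    obtain ⟨i, i', hii, ⟨a1, b1⟩, a2, b2⟩ := hc
    have hs : D.cls α = D.blocks i ∩ D.blocks i' := by
      apply Finset.eq_of_subset_of_card_le
      · intro x hx
        simp only [cls, Finset.mem_filter, Finset.mem_univ, true_and] at hx
        simp [← hx, a1, a2]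
      · rw [hint i i' hii ⟨α, by simp [a1, a2]⟩, h]
    have hb : β ∈ D.cls α := by rw [hs]; simp [b1, b2]
    simp only [cls, Finset.mem_filter, Finset.mem_univ, true_and] at hb
    exact hβ ((hb j).1 h1)

lemma eta_iff (D : BlockDesign v b r k) {μ : ℕ} (hv : 0 < v) (hr : 1 < r) (hint : D.IntProp μ) :
    (D.eta 0 : ℚ) = (v : ℚ) * ((v : ℚ) - (k : ℚ) - ((r : ℚ) - 1) * ((k : ℚ) - (μ : ℚ))) / 2
      ↔ ∀ α, (D.cls α).card = μ := by
  have hμk := D.mu_le hr hint ⟨0, hv⟩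
  have h1 := D.two_eta hr
  have h2 := Finset.sum_eq_sum_iff_of_le (s := Finset.univ) (f := fun _ : Fin v => v)
    (g := fun α => k + (r - 1) * (k - μ) + D.zz α) (fun α _ => D.bound hr hint α)
  rw [Finset.sum_add_distrib, ← h1] at h2
  simp only [Finset.sum_const, Finset.card_univ, Fintype.card_fin, smul_eq_mul,
    Finset.mem_univ, true_imp_iff, D.cls_iff hr hint] at h2
  rw [← h2, ← @Nat.cast_inj ℚ]
  push_cast [Nat.cast_sub hμk, Nat.cast_sub hr.le]
  constructor <;> intro h <;> linarith

lemma cls_of_inflation (D : BlockDesign v b r k) {μ w m : ℕ} (hr : 1 < r)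
    (E : BlockDesign w b r m) (hE : E.IntProp 1) (h : D.IsInflation μ E) (α : Fin v) :
    (D.cls α).card = μ := by
  obtain ⟨e, he⟩ := h
  obtain ⟨j, j', hne, h1, h2⟩ := E.exists_other hr (e α).1
  have hs : D.cls α = (({(e α).1} : Finset (Fin w)) ×ˢ (Finset.univ : Finset (Fin μ))).map
      e.symm.toEmbedding := by
    ext β
    simp only [cls, Finset.mem_filter, Finset.mem_univ, true_and, Finset.mem_map_equiv,
      Equiv.symm_symm, Finset.mem_product, Finset.mem_singleton, and_true, he]
    constructor
    · intro h
      have hc := hE j j' hne ⟨(e α).1, by simp [h1, h2]⟩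
      apply Finset.card_le_one.1 hc.le
      · simp [← h, h1, h2]
      · simp [h1, h2]
    · intro h
      simp [h]
  rw [hs]
  simp

lemma inflation_of_cls (D : BlockDesign v b r k) {μ : ℕ} (hb : 0 < b) (hμ : 0 < μ)
    (hint : D.IntProp μ) (h : ∀ α, (D.cls α).card = μ) :
    ∃ (w m : ℕ) (E : BlockDesign w b r m), v = μ * w ∧ k = μ * m ∧
      E.IntProp 1 ∧ D.IsInflation μ E := by
  classical
  let f : Fin v → (Fin b → Prop) := fun α j => α ∈ D.blocks j
  let Q := Set.range f
  let g : Fin v → Q := fun α => ⟨f α, α, rfl⟩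
  have hcls : ∀ α, D.cls α = Finset.univ.filter fun β => g β = g α := by
    intro α
    ext β
    simp only [cls, Finset.mem_filter, Finset.mem_univ, true_and]
    rw [Subtype.ext_iff, funext_iff]
    simp only [g, f, eq_iff_iff]
    exact forall_congr' fun j => Iff.comm
  haveI : Finite Q := Set.finite_range f
  haveI : Fintype Q := Fintype.ofFinite Q
  have hfib : ∀ q : Q, Nonempty ({α // g α = q} ≃ Fin μ) := by
    rintro ⟨_, α, rfl⟩
    refine ⟨Fintype.equivFinOfCardEq ?_⟩
    rw [Fintype.card_subtype, ← h α, hcls]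
  let e0 : Fin v ≃ Q × Fin μ :=
    (Equiv.sigmaFiberEquiv g).symm.trans
      ((Equiv.sigmaCongrRight fun q => (hfib q).some).trans (Equiv.sigmaEquivProd _ _))
  let n := Fintype.equivFin Q
  let e : Fin v ≃ Fin (Fintype.card Q) × Fin μ := e0.trans (Equiv.prodCongrLeft fun _ => n)
  have he : ∀ α, (e α).1 = n (g α) := fun α => rfl
  let B : Fin b → Finset (Fin (Fintype.card Q)) := fun j =>
    Finset.univ.filter fun x => (n.symm x).1 j
  have hB : ∀ α j, α ∈ D.blocks j ↔ (e α).1 ∈ B j := by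
    intro α j
    simp [B, he, g, f]
  have hcard : ∀ (S : Finset (Fin v)) (T : Finset (Fin (Fintype.card Q))),
      (∀ α, α ∈ S ↔ (e α).1 ∈ T) → S.card = μ * T.card := by
    intro S T hST
    have : S = (T ×ˢ (Finset.univ : Finset (Fin μ))).map e.symm.toEmbedding := by
      ext β
      simp [Finset.mem_map_equiv, hST]
    rw [this]
    simp [mul_comm]
  have hsurj : ∀ x, ∃ α, (e α).1 = x := by
    intro x
    exact ⟨e.symm (x, ⟨0, hμ⟩), by simp⟩
  have hk : ∀ j, k = μ * (B j).card := fun j => by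
    rw [← D.blockSize j]
    exact hcard _ _ fun α => hB α j
  let j0 : Fin b := ⟨0, hb⟩
  refine ⟨Fintype.card Q, (B j0).card, ⟨B, ?_, ?_⟩, ?_, hk j0, ?_, e, hB⟩
  · intro j
    exact Nat.eq_of_mul_eq_mul_left hμ ((hk j).symm.trans (hk j0))
  · intro x
    obtain ⟨α, rfl⟩ := hsurj x
    rw [← D.replication α]
    simp only [hB]
  · simpa using hcard Finset.univ Finset.univ (by simp)
  · intro j j' hne hn
    obtain ⟨x, hx⟩ := hn
    obtain ⟨α, rfl⟩ := hsurj x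
    rw [Finset.mem_inter, ← hB, ← hB, ← Finset.mem_inter] at hx
    have h1 := hint j j' hne ⟨α, hx⟩
    rw [hcard _ (B j ∩ B j') (by simp [hB])] at h1
    exact Nat.eq_of_mul_eq_mul_left hμ (by simpa using h1)

end BlockDesign

/-- Theorem 4, equality case (structural form): under the hypotheses of the bound,
`η₀(D) = v(v − k − (r−1)(k−μ))/2` holds iff `D` is a `μ`-fold inflation of a
`(v/μ, b, r, k/μ)`-design in which every pair of distinct non-disjoint blocks meet
in exactly one treatment. -/
theorem eta_zero_equality_iff_inflation (v b r k μ : ℕ) (hv : 0 < v) (hb : 0 < b)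
    (hk : 0 < k) (hr : 1 < r) (hμ : 0 < μ) (D : BlockDesign v b r k)
    (hint : ∀ j j' : Fin b, j ≠ j' → (D.blocks j ∩ D.blocks j').Nonempty →
      (D.blocks j ∩ D.blocks j').card = μ) :
    (D.eta 0 : ℚ) = (v : ℚ) * ((v : ℚ) - (k : ℚ) - ((r : ℚ) - 1) * ((k : ℚ) - (μ : ℚ))) / 2
      ↔
    ∃ (w m : ℕ) (E : BlockDesign w b r m), v = μ * w ∧ k = μ * m ∧
      (∀ j j' : Fin b, j ≠ j' → (E.blocks j ∩ E.blocks j').Nonempty →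
        (E.blocks j ∩ E.blocks j').card = 1) ∧
      D.IsInflation μ E := by
  rw [D.eta_iff hv hr hint]
  constructor
  · exact D.inflation_of_cls hb hμ hint
  · rintro ⟨w, m, E, _, _, hE, hD⟩ α
    exact D.cls_of_inflation hr E hE hD α
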